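/- (Proposition 3.) Let K ≥ 2 and α ∈ ℝ. With the double control variates b_k(x_{1:K}) = ⟨ (1/(K−1)) Σ_{j≠k} g(x_j), x_k − m ⟩, the estimator (1/K) Σ_{k=1}^K [ f(x_k) + α b_k(x_{1:K}) − (1/(K−1)) Σ_{j≠k} ( f(x_j) + α b_j(x_{1:K}) ) ] s(x_k) − α M ( (1/K) Σ_{k=1}^K g(x_k) ) is unbiased: its integral with respect to μ^K equals ∫ f(x) s(x) dμ(x). -/

import Mathlib

open MeasureTheory Finset
open scoped RealInnerProductSpace

/-- `F` is integrable with respect to `P`, and its integral is `v`. -/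
structure HasMean {Ω E : Type*} [MeasurableSpace Ω] [NormedAddCommGroup E] [NormedSpace ℝ E]
    (P : Measure Ω) (F : Ω → E) (v : E) : Prop where
  integrable : Integrable F P
  integral_eq : ∫ ω, F ω ∂P = v

namespace HasMean

variable {Ω E G : Type*} [MeasurableSpace Ω] [NormedAddCommGroup E] [NormedSpace ℝ E]
  [NormedAddCommGroup G] [NormedSpace ℝ G] {P : Measure Ω} {F F' : Ω → E} {v v' : E}

theorem add (h : HasMean P F v) (h' : HasMean P F' v') :
    HasMean P (fun ω => F ω + F' ω) (v + v') :=
  ⟨h.integrable.add h'.integrable, by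
    rw [integral_add h.integrable h'.integrable, h.integral_eq, h'.integral_eq]⟩

theorem sub (h : HasMean P F v) (h' : HasMean P F' v') :
    HasMean P (fun ω => F ω - F' ω) (v - v') :=
  ⟨h.integrable.sub h'.integrable, by
    rw [integral_sub h.integrable h'.integrable, h.integral_eq, h'.integral_eq]⟩

theorem const_smul (c : ℝ) (h : HasMean P F v) : HasMean P (fun ω => c • F ω) (c • v) :=
  ⟨h.integrable.smul c, by rw [integral_smul, h.integral_eq]⟩

theorem sum {ι : Type*} (t : Finset ι) {H : ι → Ω → E} {w : ι → E}
    (h : ∀ i ∈ t, HasMean P (H i) (w i)) :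
    HasMean P (fun ω => ∑ i ∈ t, H i ω) (∑ i ∈ t, w i) :=
  ⟨integrable_finsetSum t fun i hi => (h i hi).integrable, by
    rw [integral_finsetSum t fun i hi => (h i hi).integrable]
    exact Finset.sum_congr rfl fun i hi => (h i hi).integral_eq⟩

theorem clm_apply [CompleteSpace E] [CompleteSpace G] (L : E →L[ℝ] G) (h : HasMean P F v) :
    HasMean P (fun ω => L (F ω)) (L v) :=
  ⟨L.integrable_comp h.integrable, by rw [L.integral_comp_comm h.integrable, h.integral_eq]⟩

end HasMean

theorem ProbabilityTheory.IndepFun.hasMean_bilin {Ω 𝓧 𝓨 E F G : Type*} [MeasurableSpace Ω]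
    [MeasurableSpace 𝓧] [MeasurableSpace 𝓨]
    [NormedAddCommGroup E] [NormedSpace ℝ E] [CompleteSpace E]
    [NormedAddCommGroup F] [NormedSpace ℝ F] [CompleteSpace F]
    [NormedAddCommGroup G] [NormedSpace ℝ G] [CompleteSpace G]
    {P : Measure Ω} {X : Ω → 𝓧} {Y : Ω → 𝓨} (hXY : ProbabilityTheory.IndepFun X Y P)
    (hX : Measurable X) (hY : Measurable Y) {u : 𝓧 → E} {v : 𝓨 → F}
    (hu : Integrable u (P.map X)) (hv : Integrable v (P.map Y)) (B : E →L[ℝ] F →L[ℝ] G) :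
    HasMean P (fun ω => B (u (X ω)) (v (Y ω)))
      (B (∫ a, u a ∂(P.map X)) (∫ a, v a ∂(P.map Y))) := by
  borelize E F
  refine ⟨?_, ?_⟩
  · exact (hXY.comp₀ hX.aemeasurable hY.aemeasurable hu.aemeasurable
      hv.aemeasurable).integrable_bilin (hu.comp_measurable hX) (hv.comp_measurable hY) B
  · rw [hXY.integral_bilin_comp_comp hX.aemeasurable hY.aemeasurable hu hv B,
      integral_map hX.aemeasurable hu.1, integral_map hY.aemeasurable hv.1]

section Pi

variable {ι 𝓧 E F G : Type*} [Fintype ι] [MeasurableSpace 𝓧]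
  [NormedAddCommGroup E] [NormedSpace ℝ E] [NormedAddCommGroup F] [NormedSpace ℝ F]
  [NormedAddCommGroup G] [NormedSpace ℝ G] {μ : Measure 𝓧} [IsProbabilityMeasure μ]

theorem hasMean_pi_eval {u : 𝓧 → E} (hu : Integrable u μ) (i : ι) :
    HasMean (Measure.pi fun _ : ι => μ) (fun x => u (x i)) (∫ a, u a ∂μ) := by
  have h := measurePreserving_eval (fun _ : ι => μ) i
  refine ⟨h.integrable_comp_of_integrable hu, ?_⟩
  have h' := integral_map (μ := Measure.pi fun _ : ι => μ) (φ := Function.eval i) (f := u)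
    h.measurable.aemeasurable (by rw [h.map_eq]; exact hu.1)
  rw [h.map_eq] at h'
  exact h'.symm

theorem iIndepFun_pi_eval :
    ProbabilityTheory.iIndepFun (fun (i : ι) (x : ι → 𝓧) => x i) (Measure.pi fun _ : ι => μ) :=
  ProbabilityTheory.iIndepFun_pi (X := fun _ => id) fun _ => aemeasurable_id

variable [CompleteSpace E] [CompleteSpace F] [CompleteSpace G]

theorem hasMean_pi_bilin {i j : ι} (hij : i ≠ j) {u : 𝓧 → E} {v : 𝓧 → F}
    (hu : Integrable u μ) (hv : Integrable v μ) (B : E →L[ℝ] F →L[ℝ] G) :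
    HasMean (Measure.pi fun _ : ι => μ) (fun x => B (u (x i)) (v (x j)))
      (B (∫ a, u a ∂μ) (∫ a, v a ∂μ)) := by
  have hi := (measurePreserving_eval (fun _ : ι => μ) i).map_eq
  have hj := (measurePreserving_eval (fun _ : ι => μ) j).map_eq
  have h := (iIndepFun_pi_eval (ι := ι) (μ := μ)).indepFun hij
  have key := h.hasMean_bilin (measurable_pi_apply i) (measurable_pi_apply j) (u := u) (v := v)
    (by rw [show (fun x : ι → 𝓧 => x i) = Function.eval i from rfl, hi]; exact hu)
    (by rw [show (fun x : ι → 𝓧 => x j) = Function.eval j from rfl, hj]; exact hv) B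
  rwa [show (fun x : ι → 𝓧 => x i) = Function.eval i from rfl,
    show (fun x : ι → 𝓧 => x j) = Function.eval j from rfl, hi, hj] at key

/-- A centred factor evaluated at a coordinate not occurring in the scalar factor. -/
theorem hasMean_pi_smul_zero {i j k : ι} (hik : i ≠ k) (hjk : j ≠ k) {u : 𝓧 × 𝓧 → ℝ} {v : 𝓧 → E}
    (hum : Measurable u)
    (hu : Integrable (fun x : ι → 𝓧 => u (x i, x j)) (Measure.pi fun _ : ι => μ))
    (hv : Integrable v μ) (hv0 : ∫ a, v a ∂μ = 0) :
    HasMean (Measure.pi fun _ : ι => μ) (fun x => u (x i, x j) • v (x k)) 0 := by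
  have hk := (measurePreserving_eval (fun _ : ι => μ) k).map_eq
  have hm : Measurable fun x : ι → 𝓧 => (x i, x j) := by fun_prop
  have h := (iIndepFun_pi_eval (ι := ι) (μ := μ)).indepFun_prodMk
    (fun l => measurable_pi_apply l) i j k hik hjk
  have key := h.hasMean_bilin hm (measurable_pi_apply k) (u := u) (v := v)
    ((integrable_map_measure hum.aestronglyMeasurable hm.aemeasurable).2 hu)
    (by rw [show (fun x : ι → 𝓧 => x k) = Function.eval k from rfl, hk]; exact hv)
    (ContinuousLinearMap.lsmul ℝ ℝ)
  rw [show (fun x : ι → 𝓧 => x k) = Function.eval k from rfl, hk, hv0] at key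
  simpa using key

end Pi

section RankOne

variable {Ω V W : Type*} [MeasurableSpace Ω] [NormedAddCommGroup V] [InnerProductSpace ℝ V]
  [NormedAddCommGroup W] [InnerProductSpace ℝ W] {μ : Measure Ω}

theorem integrable_rankOne {s : Ω → W} {h : Ω → V}
    (hs : AEStronglyMeasurable s μ) (hh : AEStronglyMeasurable h μ)
    (hint : Integrable (fun x => ‖h x‖ * ‖s x‖) μ) :
    Integrable (fun x => InnerProductSpace.rankOne ℝ (s x) (h x)) μ := by
  refine hint.mono' ?_ (.of_forall fun x => ?_)
  · have hc : Continuous (Function.uncurry fun (w : W) (v : V) =>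
        (InnerProductSpace.rankOne ℝ w v : V →L[ℝ] W)) := by
      have h₁ : Continuous fun p : W × V =>
        (InnerProductSpace.rankOne ℝ p.1 : V →L⋆[ℝ] V →L[ℝ] W) :=
        (InnerProductSpace.rankOne ℝ).continuous.comp continuous_fst
      exact h₁.clm_apply continuous_snd
    exact hc.comp_aestronglyMeasurable₂ hs hh
  · simp [mul_comm]

end RankOne

theorem integral_rankOne_apply_eq_toEuclideanLin {D d : ℕ} {Ω : Type*} [MeasurableSpace Ω]
    {μ : Measure Ω} {s : Ω → EuclideanSpace ℝ (Fin d)} {h : Ω → EuclideanSpace ℝ (Fin D)}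
    (hs : AEStronglyMeasurable s μ) (hh : AEStronglyMeasurable h μ)
    (hint : Integrable (fun x => ‖h x‖ * ‖s x‖) μ) {M : Matrix (Fin d) (Fin D) ℝ}
    (hM : ∀ i j, M i j = ∫ x, s x i * h x j ∂μ) (w : EuclideanSpace ℝ (Fin D)) :
    (∫ x, InnerProductSpace.rankOne ℝ (s x) (h x) ∂μ) w = Matrix.toEuclideanLin M w := by
  have hR := integrable_rankOne hs hh hint
  have hsh : ∀ i j, Integrable (fun x => s x i * h x j) μ := fun i j => by
    refine hint.mono' ?_ (.of_forall fun x => ?_)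
    · exact (by fun_prop : Continuous fun p : EuclideanSpace ℝ (Fin d) × EuclideanSpace ℝ (Fin D) =>
        p.1 i * p.2 j).comp_aestronglyMeasurable (hs.prodMk hh)
    · rw [norm_mul, mul_comm]
      gcongr
      · exact PiLp.norm_apply_le _ _
      · exact PiLp.norm_apply_le _ _
  ext i
  have hcoord : ∀ x, (InnerProductSpace.rankOne ℝ (s x) (h x) w) i
      = ∑ j, s x i * h x j * w j := fun x => by
    simp only [InnerProductSpace.rankOne_apply, PiLp.smul_apply, smul_eq_mul, PiLp.inner_apply,
      RCLike.inner_apply, conj_trivial, Finset.sum_mul]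
    exact Finset.sum_congr rfl fun j _ => by ring
  rw [ContinuousLinearMap.integral_apply hR]
  refine ((EuclideanSpace.proj (𝕜 := ℝ) i).integral_comp_comm
    (hR.apply_continuousLinearMap w)).symm.trans ?_
  simp only [PiLp.proj_apply, hcoord]
  rw [integral_finsetSum _ fun j _ => (hsh i j).mul_const _]
  simp only [integral_mul_const, ← hM, Matrix.toLpLin_apply, Matrix.mulVec, dotProduct]

/-- Proposition 3: the double control variate estimator built from the leave-one-out
input gradients is unbiased. -/
theorem double_cv_loo_gradient_unbiased
    (D d : ℕ) (μ : Measure (EuclideanSpace ℝ (Fin D))) [IsProbabilityMeasure μ]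
    (s : EuclideanSpace ℝ (Fin D) → EuclideanSpace ℝ (Fin d))
    (f : EuclideanSpace ℝ (Fin D) → ℝ)
    (g : EuclideanSpace ℝ (Fin D) → EuclideanSpace ℝ (Fin D))
    (hs : Measurable s) (hf : Measurable f) (hg : Measurable g)
    (m : EuclideanSpace ℝ (Fin D)) (hm : m = ∫ x, x ∂μ)
    (hidInt : Integrable (fun x => x) μ)
    (hsInt : Integrable s μ) (hfInt : Integrable f μ) (hgInt : Integrable g μ)
    (hfsInt : Integrable (fun x => f x • s x) μ)
    (hsxInt : Integrable (fun x => ‖s x‖ * ‖x - m‖) μ)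
    (hgsInt : Integrable (fun x => ‖g x‖ * ‖s x‖) μ)
    (hs0 : ∫ x, s x ∂μ = 0)
    (M : Matrix (Fin d) (Fin D) ℝ)
    (hM : ∀ i j, M i j = ∫ x, s x i * (x j - m j) ∂μ)
    (K : ℕ) (hK : 2 ≤ K) (α : ℝ)
    (b : Fin K → (Fin K → EuclideanSpace ℝ (Fin D)) → ℝ)
    (hb : ∀ k x, b k x =
      ⟪((K : ℝ) - 1)⁻¹ • ∑ j ∈ univ.erase k, g (x j), x k - m⟫) :
    ∫ x, ((K : ℝ)⁻¹ •
        ∑ k, (f (x k) + α * b k x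
          - ((K : ℝ) - 1)⁻¹ * ∑ j ∈ univ.erase k, (f (x j) + α * b j x)) • s (x k)
        - α • Matrix.toEuclideanLin M ((K : ℝ)⁻¹ • ∑ k, g (x k)))
        ∂(Measure.pi fun _ : Fin K => μ)
      = ∫ y, f y • s y ∂μ := by
  set P := Measure.pi fun _ : Fin K => μ
  set T := Matrix.toEuclideanLin M (∫ y, g y ∂μ) with hT
  have hxm : Integrable (fun x => x - m) μ := hidInt.sub (integrable_const m)
  have hxm0 : ∫ x, (x - m) ∂μ = 0 := by
    rw [integral_sub hidInt (integrable_const m)]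
    simp [hm]
  have hsx : Integrable (fun x => ‖x - m‖ * ‖s x‖) μ := by simpa only [mul_comm] using hsxInt
  have hself : ∀ l k : Fin K, l ≠ k → HasMean P (fun x => ⟪g (x l), x k - m⟫ • s (x k)) T := by
    intro l k hlk
    have h := hasMean_pi_bilin hlk.symm (integrable_rankOne hsInt.1 hxm.1 hsx) hgInt (.id ℝ _)
    simp only [ContinuousLinearMap.id_apply, InnerProductSpace.rankOne_apply] at h
    rw [integral_rankOne_apply_eq_toEuclideanLin hsInt.1 hxm.1 hsx hM] at h
    simpa only [real_inner_comm] using h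
  have hcross : ∀ l j k : Fin K, l ≠ j → j ≠ k →
      HasMean P (fun x => ⟪g (x l), x j - m⟫ • s (x k)) 0 := by
    intro l j k hlj hjk
    by_cases hlk : l = k
    · subst hlk
      have h := hasMean_pi_bilin hlj (integrable_rankOne hsInt.1 hgInt.1 hgsInt) hxm (.id ℝ _)
      simpa only [ContinuousLinearMap.id_apply, InnerProductSpace.rankOne_apply, hxm0,
        map_zero] using h
    · exact hasMean_pi_smul_zero hlk hjk (u := fun p => ⟪g p.1, p.2 - m⟫)
        (by fun_prop) (hasMean_pi_bilin hlj hgInt hxm (innerSL ℝ)).integrable hsInt hs0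
  have hfcross : ∀ j k : Fin K, j ≠ k → HasMean P (fun x => f (x j) • s (x k)) 0 := by
    intro j k hjk
    simpa [hs0] using hasMean_pi_bilin hjk hfInt hsInt (ContinuousLinearMap.lsmul ℝ ℝ)
  have hbs : ∀ j k x, b j x • s (x k)
      = ((K : ℝ) - 1)⁻¹ • ∑ l ∈ univ.erase j, ⟪g (x l), x j - m⟫ • s (x k) := by
    intro j k x
    rw [hb, real_inner_smul_left, sum_inner, mul_smul, Finset.sum_smul]
  have hK1 : ((K : ℝ) - 1) ≠ 0 := by
    have : (2 : ℝ) ≤ K := by exact_mod_cast hK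
    linarith
  have hK0 : (K : ℝ) ≠ 0 := by positivity
  have hbself : ∀ k, HasMean P (fun x => b k x • s (x k)) T := by
    intro k
    have h := (HasMean.sum (univ.erase k) fun l hl =>
      hself l k (Finset.ne_of_mem_erase hl)).const_smul ((K : ℝ) - 1)⁻¹
    simp only [← hbs] at h
    rw [Finset.sum_const, Finset.card_erase_of_mem (mem_univ k), Finset.card_univ,
      Fintype.card_fin, ← Nat.cast_smul_eq_nsmul ℝ, Nat.cast_sub (by lia), Nat.cast_one,
      inv_smul_smul₀ hK1] at h
    exact h
  have hbcross : ∀ j k, j ≠ k → HasMean P (fun x => b j x • s (x k)) 0 := by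
    intro j k hjk
    have h := (HasMean.sum (univ.erase j) fun l hl =>
      hcross l j k (Finset.ne_of_mem_erase hl) hjk).const_smul ((K : ℝ) - 1)⁻¹
    simpa only [← hbs, Finset.sum_const_zero, smul_zero] using h
  have hterm : ∀ k, HasMean P (fun x => (f (x k) + α * b k x
      - ((K : ℝ) - 1)⁻¹ * ∑ j ∈ univ.erase k, (f (x j) + α * b j x)) • s (x k))
      (∫ y, f y • s y ∂μ + α • T) := by
    intro k
    have h := ((hasMean_pi_eval hfsInt k).add ((hbself k).const_smul α)).sub
      ((HasMean.sum (univ.erase k) fun j hj =>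
        (hfcross j k (Finset.ne_of_mem_erase hj)).add
          ((hbcross j k (Finset.ne_of_mem_erase hj)).const_smul α)).const_smul ((K : ℝ) - 1)⁻¹)
    simpa only [sub_smul, add_smul, mul_smul, Finset.sum_smul, smul_zero, add_zero,
      Finset.sum_const_zero, sub_zero] using h
  have hmean : ∀ {E : Type} [NormedAddCommGroup E] [NormedSpace ℝ E] (v : E),
      (K : ℝ)⁻¹ • ∑ _k : Fin K, v = v := by
    intro E _ _ v
    rw [Finset.sum_const, Finset.card_univ, Fintype.card_fin, ← Nat.cast_smul_eq_nsmul ℝ,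
      inv_smul_smul₀ hK0]
  have hgmean := (((HasMean.sum univ fun k _ => hasMean_pi_eval (ι := Fin K) hgInt k).const_smul
    (K : ℝ)⁻¹).clm_apply (Matrix.toEuclideanLin M).toContinuousLinearMap).const_smul α
  have h := ((HasMean.sum univ fun k _ => hterm k).const_smul (K : ℝ)⁻¹).sub hgmean
  rw [hmean, hmean] at h
  refine h.integral_eq.trans ?_
  simp [hT]
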